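/- For all integers n ≥ 0 and α ≥ 0, ped(3^{2α+3}·n + (17·3^{2α+2} − 1)/8) ≡ 0 (mod 3). -/

import Mathlib

/-- `ped n`: number of partitions of `n` in which even parts are not repeated. -/
noncomputable def ped (n : ℕ) : ℕ :=
  Nat.card {p : n.Partition // ∀ i, Even i → p.parts.count i ≤ 1}

open PowerSeries PowerSeries.WithPiTopology Filter Topology

/-- The triangular number `n (n + 1) / 2` of an integer `n`. -/
def triangular (n : ℤ) : ℕ := (n * (n + 1) / 2).toNat

theorem two_mul_triangular (n : ℤ) : 2 * (triangular n : ℤ) = n * (n + 1) := by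
  have h0 : 0 ≤ n * (n + 1) := by
    rcases le_or_gt 0 n with h | h
    · positivity
    · nlinarith
  have h2 : 2 ∣ n * (n + 1) := (Int.even_mul_succ_self n).two_dvd
  rw [triangular, Int.toNat_of_nonneg (by positivity), Int.mul_ediv_cancel' h2]

theorem triangular_add_one (n : ℤ) : (triangular (n + 1) : ℤ) = triangular n + n + 1 := by
  linarith [two_mul_triangular n, two_mul_triangular (n + 1)]

theorem triangular_neg (n : ℤ) : (triangular (-n) : ℤ) = triangular n - n := by
  linarith [two_mul_triangular n, two_mul_triangular (-n)]

section FiniteTripleProduct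

variable {R : Type*} [CommRing R]

/-- The general term of Ramanujan's theta series `f(a, b)`. -/
def thetaTerm (a b : R) (n : ℤ) : R := a ^ triangular n * b ^ triangular (-n)

theorem thetaTerm_neg (a b : R) (n : ℤ) : thetaTerm a b (-n) = thetaTerm b a n := by
  simp [thetaTerm, mul_comm]

theorem mul_thetaTerm (a b : R) {M j : ℕ} {m : ℤ} (h : (j : ℤ) + m = M) :
    a * (a * b) ^ M * thetaTerm a b m = (a * b) ^ j * thetaTerm a b (m + 1) := by
  have h1 : 1 + M + triangular m = j + triangular (m + 1) := by
    zify; linarith [triangular_add_one m]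
  have h2 : M + triangular (-m) = j + triangular (-(m + 1)) := by
    zify; linarith [triangular_add_one m, triangular_neg m, triangular_neg (m + 1)]
  calc a * (a * b) ^ M * thetaTerm a b m
      = a ^ (1 + M + triangular m) * b ^ (M + triangular (-m)) := by
        simp only [thetaTerm]; ring
    _ = _ := by rw [h1, h2]; simp only [thetaTerm]; ring

theorem mul_thetaTerm' (a b : R) {N i : ℕ} {m : ℤ} (h : (N : ℤ) + m = i) :
    b * (a * b) ^ N * thetaTerm a b m = (a * b) ^ i * thetaTerm a b (m - 1) := by
  have := mul_thetaTerm b a (M := N) (j := i) (m := -m) (by omega)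
  rw [thetaTerm_neg, show -m + 1 = -(m - 1) by ring, thetaTerm_neg] at this
  rw [mul_comm a b, this]

open Finset.Nat in
theorem sum_antidiagonal_succ_of_pascal {B w₁ w₂ : ℕ → ℕ → R}
    (hB : ∀ i j, B (i + 1) (j + 1) = w₁ i (j + 1) * B i (j + 1) + w₂ (i + 1) j * B (i + 1) j)
    (h0 : ∀ i, B i 0 = 1) (h0' : ∀ j, B 0 j = 1) (hw₁ : ∀ i, w₁ i 0 = 1) (hw₂ : ∀ j, w₂ 0 j = 1)
    (g : ℕ → ℕ → R) (n : ℕ) :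
    ∑ x ∈ Finset.HasAntidiagonal.antidiagonal (n + 1), B x.1 x.2 * g x.1 x.2 =
      ∑ x ∈ Finset.HasAntidiagonal.antidiagonal n,
        B x.1 x.2 * (w₁ x.1 x.2 * g (x.1 + 1) x.2 + w₂ x.1 x.2 * g x.1 (x.2 + 1)) := by
  let G₁ : ℕ × ℕ → R := fun x ↦
    if x.1 = 0 then 0 else w₁ (x.1 - 1) x.2 * B (x.1 - 1) x.2 * g x.1 x.2
  let G₂ : ℕ × ℕ → R := fun x ↦
    if x.2 = 0 then 0 else w₂ x.1 (x.2 - 1) * B x.1 (x.2 - 1) * g x.1 x.2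
  have e₁ : ∑ x ∈ Finset.HasAntidiagonal.antidiagonal (n + 1), G₁ x =
      ∑ x ∈ Finset.HasAntidiagonal.antidiagonal n, w₁ x.1 x.2 * B x.1 x.2 * g (x.1 + 1) x.2 := by
    rw [sum_antidiagonal_succ]; simp [G₁]
  have e₂ : ∑ x ∈ Finset.HasAntidiagonal.antidiagonal (n + 1), G₂ x =
      ∑ x ∈ Finset.HasAntidiagonal.antidiagonal n, w₂ x.1 x.2 * B x.1 x.2 * g x.1 (x.2 + 1) := by
    rw [sum_antidiagonal_succ']; simp [G₂]
  trans ∑ x ∈ Finset.HasAntidiagonal.antidiagonal (n + 1), (G₁ x + G₂ x)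
  · refine Finset.sum_congr rfl fun ⟨i, j⟩ hx ↦ ?_
    rcases i with _ | i <;> rcases j with _ | j
    · simp at hx
    · simp [G₁, G₂, h0', hw₂]
    · simp [G₁, G₂, h0, hw₁]
    · simp [G₁, G₂, hB]; ring
  · rw [Finset.sum_add_distrib, e₁, e₂, ← Finset.sum_add_distrib]
    exact Finset.sum_congr rfl fun x _ ↦ by ring

/-- A finite form of the Jacobi triple product identity. -/
theorem prod_mul_prod_eq_sum_antidiagonal {B : ℕ → ℕ → R} (a b : R)
    (hB : ∀ i j, B (i + 1) (j + 1) = (a * b) ^ (j + 1) * B i (j + 1) + B (i + 1) j)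
    (hB' : ∀ i j, B (i + 1) (j + 1) = B i (j + 1) + (a * b) ^ (i + 1) * B (i + 1) j)
    (h0 : ∀ i, B i 0 = 1) (h0' : ∀ j, B 0 j = 1) (M N : ℕ) :
    (∏ k ∈ Finset.range M, (1 + a * (a * b) ^ k)) * (∏ k ∈ Finset.range N, (1 + b * (a * b) ^ k)) =
      ∑ x ∈ Finset.HasAntidiagonal.antidiagonal (M + N), B x.1 x.2 * thetaTerm a b (x.1 - N) := by
  induction M with
  | zero =>
    induction N with
    | zero => simp [h0, thetaTerm, triangular]
    | succ N ih =>
      simp only [Finset.range_zero, Finset.prod_empty, one_mul, zero_add] at ih ⊢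
      rw [sum_antidiagonal_succ_of_pascal (w₁ := fun _ _ ↦ 1) (w₂ := fun i _ ↦ (a * b) ^ i)
        (by simpa using hB') h0 h0' (by simp) (by simp)
        (fun i _ ↦ thetaTerm a b (i - (N + 1 : ℕ))), Finset.prod_range_succ, ih, Finset.sum_mul]
      refine Finset.sum_congr rfl fun ⟨i, j⟩ _ ↦ ?_
      have := mul_thetaTerm' a b (N := N) (i := i) (m := i - N) (by ring)
      push_cast
      rw [show (i : ℤ) - (N + 1) = i - N - 1 by ring, show (i : ℤ) + 1 - (N + 1) = i - N by ring]
      linear_combination B i j * this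
  | succ M ih =>
    rw [show M + 1 + N = M + N + 1 by ring,
      sum_antidiagonal_succ_of_pascal (w₁ := fun _ j ↦ (a * b) ^ j) (w₂ := fun _ _ ↦ 1)
        (by simpa using hB) h0 h0' (by simp) (by simp)
        (fun i _ ↦ thetaTerm a b (i - N)), Finset.prod_range_succ, mul_right_comm, ih,
      Finset.sum_mul]
    refine Finset.sum_congr rfl fun ⟨i, j⟩ hx ↦ ?_
    rw [Finset.HasAntidiagonal.mem_antidiagonal] at hx
    have := mul_thetaTerm a b (M := M) (j := j) (m := i - N) (by simp at hx; omega)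
    push_cast
    rw [show (i : ℤ) + 1 - N = i - N + 1 by ring]
    linear_combination B i j * this

end FiniteTripleProduct

section TripleProduct

variable {K : Type*} [Field K]

/-- The finite product `(1 - Q) (1 - Q²) ⋯ (1 - Qⁿ)`. -/
noncomputable def qFactorial (Q : K⟦X⟧) (n : ℕ) : K⟦X⟧ := ∏ i ∈ Finset.range n, (1 - Q ^ (i + 1))

theorem qFactorial_succ (Q : K⟦X⟧) (n : ℕ) :
    qFactorial Q (n + 1) = qFactorial Q n * (1 - Q ^ (n + 1)) := Finset.prod_range_succ ..

theorem constantCoeff_qFactorial {Q : K⟦X⟧} (hQ : X ∣ Q) (n : ℕ) :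
    constantCoeff (qFactorial Q n) = 1 := by
  rw [X_dvd_iff] at hQ
  simp [qFactorial, map_prod, hQ]

theorem X_pow_dvd_qFactorial_sub {Q : K⟦X⟧} (hQ : X ∣ Q) {d m n : ℕ} (hm : d ≤ m) (hn : d ≤ n) :
    X ^ d ∣ qFactorial Q m - qFactorial Q n := by
  suffices h : ∀ k, X ^ d ∣ qFactorial Q (d + k) - qFactorial Q d by
    obtain ⟨k, rfl⟩ := Nat.exists_eq_add_of_le hm
    obtain ⟨l, rfl⟩ := Nat.exists_eq_add_of_le hn
    simpa using dvd_sub (h k) (h l)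
  intro k
  induction k with
  | zero => simp
  | succ k ih =>
    rw [← add_assoc, qFactorial_succ, mul_sub, mul_one, sub_right_comm]
    refine dvd_sub ih (Dvd.dvd.mul_left ?_ _)
    exact (pow_dvd_pow _ (by omega)).trans (pow_dvd_pow_of_dvd hQ _)

/-- The Gaussian binomial coefficient `[i + j, i]` as a power series. -/
noncomputable def qBinomial (Q : K⟦X⟧) (i j : ℕ) : K⟦X⟧ :=
  qFactorial Q (i + j) * (qFactorial Q i * qFactorial Q j)⁻¹

theorem qBinomial_mul {Q : K⟦X⟧} (hQ : X ∣ Q) (i j : ℕ) :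
    qBinomial Q i j * (qFactorial Q i * qFactorial Q j) = qFactorial Q (i + j) := by
  rw [qBinomial, mul_assoc, PowerSeries.inv_mul_cancel, mul_one]
  simp [constantCoeff_qFactorial hQ]

theorem qFactorial_ne_zero {Q : K⟦X⟧} (hQ : X ∣ Q) (n : ℕ) : qFactorial Q n ≠ 0 := by
  intro h
  simpa [h] using constantCoeff_qFactorial hQ n

theorem qBinomial_unique {Q : K⟦X⟧} (hQ : X ∣ Q) {i j : ℕ} {B : K⟦X⟧}
    (h : B * (qFactorial Q i * qFactorial Q j) = qFactorial Q (i + j)) : qBinomial Q i j = B :=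
  mul_right_cancel₀ (mul_ne_zero (qFactorial_ne_zero hQ i) (qFactorial_ne_zero hQ j))
    ((qBinomial_mul hQ i j).trans h.symm)

theorem qBinomial_zero_right {Q : K⟦X⟧} (hQ : X ∣ Q) (i : ℕ) : qBinomial Q i 0 = 1 :=
  qBinomial_unique hQ (by simp [qFactorial])

theorem qBinomial_zero_left {Q : K⟦X⟧} (hQ : X ∣ Q) (j : ℕ) : qBinomial Q 0 j = 1 :=
  qBinomial_unique hQ (by simp [qFactorial])

theorem qBinomial_succ_succ {Q : K⟦X⟧} (hQ : X ∣ Q) (i j : ℕ) :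
    qBinomial Q (i + 1) (j + 1) = Q ^ (j + 1) * qBinomial Q i (j + 1) + qBinomial Q (i + 1) j := by
  apply qBinomial_unique hQ
  have h₁ := qBinomial_mul hQ i (j + 1)
  have h₂ := qBinomial_mul hQ (i + 1) j
  rw [show i + (j + 1) = i + j + 1 by ring] at h₁
  rw [show i + 1 + j = i + j + 1 by ring] at h₂
  rw [show i + 1 + (j + 1) = i + j + 1 + 1 by ring, qFactorial_succ Q (i + j + 1)]
  have h₃ := qFactorial_succ Q i
  have h₄ := qFactorial_succ Q j
  rw [h₃] at h₂ ⊢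
  rw [h₄] at h₁ ⊢
  linear_combination Q ^ (j + 1) * (1 - Q ^ (i + 1)) * h₁ + (1 - Q ^ (j + 1)) * h₂

theorem qBinomial_comm (Q : K⟦X⟧) (i j : ℕ) : qBinomial Q i j = qBinomial Q j i := by
  rw [qBinomial, qBinomial, add_comm, mul_comm (qFactorial Q i)]

theorem qBinomial_succ_succ' {Q : K⟦X⟧} (hQ : X ∣ Q) (i j : ℕ) :
    qBinomial Q (i + 1) (j + 1) = qBinomial Q i (j + 1) + Q ^ (i + 1) * qBinomial Q (i + 1) j := by
  rw [qBinomial_comm, qBinomial_succ_succ hQ, qBinomial_comm Q j, qBinomial_comm Q (j + 1), add_comm]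

theorem X_pow_dvd_qFactorial_mul_qBinomial_sub_one {Q : K⟦X⟧} (hQ : X ∣ Q) {d N i j : ℕ}
    (hN : d ≤ N) (hi : d ≤ i) (hj : d ≤ j) : X ^ d ∣ qFactorial Q N * qBinomial Q i j - 1 := by
  have hu : IsUnit (qFactorial Q i * qFactorial Q j) := by
    rw [PowerSeries.isUnit_iff_constantCoeff]
    simp [constantCoeff_qFactorial hQ]
  rw [← hu.dvd_mul_right]
  have h : (qFactorial Q N * qBinomial Q i j - 1) * (qFactorial Q i * qFactorial Q j) =
      qFactorial Q N * (qFactorial Q (i + j) - qFactorial Q j) +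
        (qFactorial Q N - qFactorial Q i) * qFactorial Q j := by
    linear_combination qFactorial Q N * qBinomial_mul hQ i j
  rw [h]
  exact dvd_add ((X_pow_dvd_qFactorial_sub hQ (by omega) hj).mul_left _)
    ((X_pow_dvd_qFactorial_sub hQ hN hi).mul_right _)

theorem X_pow_dvd_thetaTerm {a b : K⟦X⟧} (ha : X ∣ a) (hb : X ∣ b) {d : ℕ} {n : ℤ}
    (hn : d ≤ n.natAbs) : X ^ d ∣ thetaTerm a b n := by
  have h : X ^ (triangular n + triangular (-n)) ∣ thetaTerm a b n := by
    rw [pow_add]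
    exact mul_dvd_mul (pow_dvd_pow_of_dvd ha _) (pow_dvd_pow_of_dvd hb _)
  refine (pow_dvd_pow _ ?_).trans h
  have h1 := two_mul_triangular n
  have h2 := two_mul_triangular (-n)
  have h3 : ((n.natAbs : ℤ)) ^ 2 = n ^ 2 := Int.natAbs_sq n
  have h4 : n.natAbs ≤ n.natAbs ^ 2 := Nat.le_self_pow (by norm_num) _
  have h5 : triangular n + triangular (-n) = n.natAbs ^ 2 := by
    zify
    rw [sq_abs]
    linarith
  omega

theorem coeff_thetaTerm_eq_zero {a b : K⟦X⟧} (ha : X ∣ a) (hb : X ∣ b) {d : ℕ} {n : ℤ}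
    (hn : d < n.natAbs) : coeff d (thetaTerm a b n) = 0 :=
  X_pow_dvd_iff.mp (X_pow_dvd_thetaTerm ha hb (Nat.succ_le_of_lt hn)) d (Nat.lt_succ_self d)

variable [TopologicalSpace K]

/-- Ramanujan's theta series `f(a, b)`. -/
noncomputable def ramanujanTheta (a b : K⟦X⟧) : K⟦X⟧ := ∑' n : ℤ, thetaTerm a b n

theorem hasSum_ramanujanTheta {a b : K⟦X⟧} (ha : X ∣ a) (hb : X ∣ b) :
    HasSum (thetaTerm a b) (ramanujanTheta a b) := by
  refine Summable.hasSum ((summable_iff_summable_coeff K).mpr fun d ↦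
    summable_of_hasFiniteSupport ?_)
  refine (Set.finite_Icc (-(d : ℤ)) d).subset fun n hn ↦ ?_
  by_contra h
  exact hn (coeff_thetaTerm_eq_zero ha hb (by simp at h; omega))

theorem coeff_ramanujanTheta [T2Space K] {a b : K⟦X⟧} (ha : X ∣ a) (hb : X ∣ b) (d : ℕ) :
    coeff d (ramanujanTheta a b) =
      ∑ n ∈ Finset.Icc (-(d : ℤ)) d, coeff d (thetaTerm a b n) := by
  have h := (hasSum_iff_hasSum_coeff K).mp (hasSum_ramanujanTheta ha hb) d
  refine h.unique (hasSum_sum_of_ne_finset_zero fun n hn ↦ ?_)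
  exact coeff_thetaTerm_eq_zero ha hb (by simp at hn; omega)

/-- The **Jacobi triple product identity** for power series. -/
theorem tendsto_prod_ramanujanTheta [T2Space K] {a b : K⟦X⟧} (ha : X ∣ a) (hb : X ∣ b) :
    Tendsto (fun N ↦ ∏ k ∈ Finset.range N,
      ((1 + a * (a * b) ^ k) * (1 + b * (a * b) ^ k) * (1 - (a * b) ^ (k + 1)))) atTop
      (𝓝 (ramanujanTheta a b)) := by
  have hQ : X ∣ a * b := ha.mul_right b
  rw [tendsto_iff_coeff_tendsto]
  refine fun d ↦ tendsto_atTop_of_eventually_const (i₀ := 2 * d + 1) fun N hN ↦ ?_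
  rw [coeff_ramanujanTheta ha hb, Finset.prod_mul_distrib, Finset.prod_mul_distrib,
    prod_mul_prod_eq_sum_antidiagonal a b (qBinomial_succ_succ hQ) (qBinomial_succ_succ' hQ)
    (qBinomial_zero_right hQ) (qBinomial_zero_left hQ), ← qFactorial, Finset.sum_mul, map_sum]
  have hterm (x : ℕ × ℕ) (hx : x ∈ Finset.HasAntidiagonal.antidiagonal (N + N)) :
      coeff d (qBinomial (a * b) x.1 x.2 * thetaTerm a b (x.1 - N) * qFactorial (a * b) N) =
        coeff d (thetaTerm a b (x.1 - N)) := by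
    rw [← sub_eq_zero, ← map_sub]
    suffices h : X ^ (d + 1) ∣ qBinomial (a * b) x.1 x.2 * thetaTerm a b (x.1 - N) *
        qFactorial (a * b) N - thetaTerm a b (x.1 - N) from X_pow_dvd_iff.mp h d (by omega)
    rw [show qBinomial (a * b) x.1 x.2 * thetaTerm a b (x.1 - N) * qFactorial (a * b) N -
      thetaTerm a b (x.1 - N) = (qFactorial (a * b) N * qBinomial (a * b) x.1 x.2 - 1) *
        thetaTerm a b (x.1 - N) by ring]
    rw [Finset.HasAntidiagonal.mem_antidiagonal] at hx
    rcases le_or_gt (d + 1) ((x.1 : ℤ) - N).natAbs with h | h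
    · exact (X_pow_dvd_thetaTerm ha hb h).mul_left _
    · exact (X_pow_dvd_qFactorial_mul_qBinomial_sub_one hQ (by omega) (by omega)
        (by omega)).mul_right _
  rw [Finset.sum_congr rfl hterm, Finset.Nat.sum_antidiagonal_eq_sum_range_succ_mk]
  symm
  refine Finset.sum_of_injOn (fun n ↦ (n + N).toNat) ?_ ?_ ?_ ?_
  · intro m hm n hn h
    simp at hm hn h
    omega
  · intro n hn
    simp at hn ⊢
    omega
  · intro i _ h
    refine coeff_thetaTerm_eq_zero ha hb ?_
    by_contra h'
    exact h ⟨(i : ℤ) - N, by simp; omega, by simp⟩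
  · intro n hn
    simp at hn
    simp only
    rw [Int.toNat_of_nonneg (by omega), add_sub_cancel_right]

end TripleProduct

section EulerProducts

variable {K : Type*} [Field K]

theorem prod_range_three_mul {M : Type*} [CommMonoid M] (f : ℕ → M) (N : ℕ) :
    ∏ i ∈ Finset.range (3 * (N + 1)), f i =
      (∏ i ∈ Finset.range (3 * N), f i) * (f (3 * N) * f (3 * N + 1) * f (3 * N + 2)) := by
  rw [show 3 * (N + 1) = 3 * N + 1 + 1 + 1 by ring, Finset.prod_range_succ, Finset.prod_range_succ,
    Finset.prod_range_succ, mul_assoc, mul_assoc, mul_assoc]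

theorem prod_range_two_mul {M : Type*} [CommMonoid M] (f : ℕ → M) (N : ℕ) :
    ∏ i ∈ Finset.range (2 * (N + 1)), f i =
      (∏ i ∈ Finset.range (2 * N), f i) * (f (2 * N) * f (2 * N + 1)) := by
  rw [show 2 * (N + 1) = 2 * N + 1 + 1 by ring, Finset.prod_range_succ, Finset.prod_range_succ,
    mul_assoc]

theorem prod_range_four_mul {M : Type*} [CommMonoid M] (f : ℕ → M) (N : ℕ) :
    ∏ i ∈ Finset.range (4 * (N + 1)), f i =
      (∏ i ∈ Finset.range (4 * N), f i) *
        (f (4 * N) * f (4 * N + 1) * f (4 * N + 2) * f (4 * N + 3)) := by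
  rw [show 4 * (N + 1) = 4 * N + 1 + 1 + 1 + 1 by ring, Finset.prod_range_succ,
    Finset.prod_range_succ, Finset.prod_range_succ, Finset.prod_range_succ, mul_assoc, mul_assoc,
    mul_assoc, mul_assoc, mul_assoc]

theorem tendsto_mul_left_atTop {c : ℕ} (hc : 0 < c) : Tendsto (fun N ↦ c * N) atTop atTop :=
  tendsto_atTop_mono (fun N ↦ Nat.le_mul_of_pos_left N hc) tendsto_id

variable (K) [TopologicalSpace K]

theorem multipliable_one_add_smul_X_pow (c : K) {e : ℕ → ℕ} (he : ∀ i, i < e i) :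
    Multipliable fun i ↦ (1 + C c * X ^ e i : K⟦X⟧) := by
  apply multipliable_one_add_of_tendsto_order_atTop_nhds_top
  refine ENat.tendsto_nhds_top_iff_natCast_lt.mpr fun n ↦ eventually_atTop.mpr ⟨n, fun m hm ↦ ?_⟩
  refine lt_of_lt_of_le ?_ (le_order_mul _ _)
  rw [order_X_pow]
  refine lt_of_lt_of_le (b := (e m : ℕ∞)) ?_ le_add_self
  exact_mod_cast hm.trans_lt (he m)

/-- Euler's product `f_m = (1 - q^m) (1 - q^(2 m)) (1 - q^(3 m)) ⋯`. -/
noncomputable def eulerProduct (m : ℕ) : K⟦X⟧ := ∏' i, (1 - X ^ (m * (i + 1)))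

/-- The product `(1 + q^m) (1 + q^(3 m)) (1 + q^(5 m)) ⋯`. -/
noncomputable def oddProduct (m : ℕ) : K⟦X⟧ := ∏' i, (1 + X ^ (m * (2 * i + 1)))

theorem tendsto_eulerProduct {m : ℕ} (hm : 0 < m) {c : ℕ} (hc : 0 < c) :
    Tendsto (fun N ↦ ∏ i ∈ Finset.range (c * N), (1 - X ^ (m * (i + 1)))) atTop
      (𝓝 (eulerProduct K m)) := by
  have h := multipliable_one_add_smul_X_pow K (-1) (e := fun i ↦ m * (i + 1))
    (fun i ↦ by nlinarith)
  simp only [map_neg, map_one, neg_mul, one_mul, ← sub_eq_add_neg] at h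
  exact h.tendsto_prod_tprod_nat.comp (tendsto_mul_left_atTop hc)

theorem tendsto_oddProduct {m : ℕ} (hm : 0 < m) {c : ℕ} (hc : 0 < c) :
    Tendsto (fun N ↦ ∏ i ∈ Finset.range (c * N), (1 + X ^ (m * (2 * i + 1)))) atTop
      (𝓝 (oddProduct K m)) := by
  have h := multipliable_one_add_smul_X_pow K 1 (e := fun i ↦ m * (2 * i + 1))
    (fun i ↦ by nlinarith)
  simp only [map_one, one_mul] at h
  exact h.tendsto_prod_tprod_nat.comp (tendsto_mul_left_atTop hc)

variable [T2Space K]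

theorem constantCoeff_eulerProduct {m : ℕ} (hm : 0 < m) :
    constantCoeff (eulerProduct K m) = 1 := by
  refine tendsto_nhds_unique
    (((continuous_constantCoeff K).tendsto _).comp (tendsto_eulerProduct K hm one_pos)) ?_
  simp [Function.comp_def, map_prod, hm.ne']

theorem eulerProduct_ne_zero {m : ℕ} (hm : 0 < m) : eulerProduct K m ≠ 0 := fun h ↦ by
  simpa [h] using constantCoeff_eulerProduct K hm

variable [IsTopologicalRing K]

theorem oddProduct_mul {m : ℕ} (hm : 0 < m) :
    oddProduct K m * eulerProduct K m * eulerProduct K (4 * m) = eulerProduct K (2 * m) ^ 2 := by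
  have h := ((tendsto_oddProduct K hm one_pos).mul (tendsto_eulerProduct K hm two_pos)).mul
    (tendsto_eulerProduct K (m := 4 * m) (by omega) one_pos)
  have h' := (tendsto_eulerProduct K (m := 2 * m) (by omega) two_pos).mul
    (tendsto_eulerProduct K (m := 2 * m) (by omega) one_pos)
  rw [sq]
  refine tendsto_nhds_unique h (h'.congr fun N ↦ ?_)
  simp only [one_mul]
  induction N with
  | zero => simp
  | succ N ih =>
    simp only [prod_range_two_mul, Finset.prod_range_succ]
    linear_combination (1 - X ^ (2 * m * (2 * N + 1))) * (1 - X ^ (2 * m * (2 * N + 1 + 1))) *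
      (1 - X ^ (2 * m * (N + 1))) * ih

theorem ramanujanTheta_one_two {m : ℕ} (hm : 0 < m) :
    ramanujanTheta (X ^ m : K⟦X⟧) (X ^ (2 * m)) * eulerProduct K m * eulerProduct K (6 * m) =
      eulerProduct K (2 * m) * eulerProduct K (3 * m) ^ 2 := by
  have h := ((tendsto_prod_ramanujanTheta (dvd_pow_self (X : K⟦X⟧) hm.ne')
    (dvd_pow_self (X : K⟦X⟧) (n := 2 * m) (by omega))).mul
    (tendsto_eulerProduct K hm three_pos)).mul
    (tendsto_eulerProduct K (m := 6 * m) (by omega) one_pos)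
  have h' := (tendsto_eulerProduct K (m := 2 * m) (by omega) three_pos).mul
    ((tendsto_eulerProduct K (m := 3 * m) (by omega) one_pos).pow 2)
  refine tendsto_nhds_unique h (h'.congr fun N ↦ ?_)
  simp only [one_mul]
  induction N with
  | zero => simp
  | succ N ih =>
    simp only [prod_range_three_mul, Finset.prod_range_succ]
    linear_combination (1 - X ^ (2 * m * (3 * N + 1))) * (1 - X ^ (2 * m * (3 * N + 1 + 1))) *
      (1 - X ^ (2 * m * (3 * N + 2 + 1))) * (1 - X ^ (3 * m * (N + 1))) ^ 2 * ih

theorem ramanujanTheta_one_five :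
    ramanujanTheta (X : K⟦X⟧) (X ^ 5) * eulerProduct K 1 * eulerProduct K 4 * eulerProduct K 6 =
      eulerProduct K 2 ^ 2 * eulerProduct K 3 * eulerProduct K 12 := by
  have h := (tendsto_prod_ramanujanTheta (dvd_refl (X : K⟦X⟧))
    (dvd_pow_self (X : K⟦X⟧) (n := 5) (by omega))).mul
    (tendsto_oddProduct K three_pos one_pos)
  have h' := (tendsto_oddProduct K one_pos three_pos).mul
    (tendsto_eulerProduct K (m := 6) (by omega) one_pos)
  have key : ramanujanTheta (X : K⟦X⟧) (X ^ 5) * oddProduct K 3 =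
      oddProduct K 1 * eulerProduct K 6 := by
    refine tendsto_nhds_unique h (h'.congr fun N ↦ ?_)
    simp only [one_mul]
    induction N with
    | zero => simp
    | succ N ih =>
      simp only [prod_range_three_mul, Finset.prod_range_succ]
      linear_combination (1 + X ^ (2 * (3 * N) + 1)) * (1 + X ^ (2 * (3 * N + 1) + 1)) *
        (1 + X ^ (2 * (3 * N + 2) + 1)) * (1 - X ^ (6 * (N + 1))) * ih
  have h₁ := oddProduct_mul K one_pos
  have h₃ := oddProduct_mul K three_pos
  norm_num at h₁ h₃
  apply mul_right_cancel₀ (eulerProduct_ne_zero K (m := 6) (by norm_num))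
  linear_combination eulerProduct K 3 * eulerProduct K 12 * eulerProduct K 1 * eulerProduct K 4 * key
    + eulerProduct K 6 * eulerProduct K 3 * eulerProduct K 12 * h₁
    - ramanujanTheta (X : K⟦X⟧) (X ^ 5) * eulerProduct K 1 * eulerProduct K 4 * h₃

theorem ramanujanTheta_one_three :
    ramanujanTheta (X : K⟦X⟧) (X ^ 3) * eulerProduct K 1 = eulerProduct K 2 ^ 2 := by
  have h := tendsto_prod_ramanujanTheta (dvd_refl (X : K⟦X⟧))
    (dvd_pow_self (X : K⟦X⟧) (n := 3) (by omega))
  have h' := (tendsto_oddProduct K one_pos two_pos).mul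
    (tendsto_eulerProduct K (m := 4) (by omega) one_pos)
  have key : ramanujanTheta (X : K⟦X⟧) (X ^ 3) = oddProduct K 1 * eulerProduct K 4 := by
    refine tendsto_nhds_unique h (h'.congr fun N ↦ ?_)
    simp only [one_mul]
    induction N with
    | zero => simp
    | succ N ih =>
      simp only [prod_range_two_mul, Finset.prod_range_succ]
      linear_combination (1 + X ^ (2 * (2 * N) + 1)) * (1 + X ^ (2 * (2 * N + 1) + 1)) *
        (1 - X ^ (4 * (N + 1))) * ih
  have h₁ := oddProduct_mul K one_pos
  norm_num at h₁
  linear_combination eulerProduct K 1 * key + h₁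

theorem ramanujanTheta_neg_one_neg_three :
    ramanujanTheta (-X : K⟦X⟧) (-X ^ 3) * eulerProduct K 2 =
      eulerProduct K 1 * eulerProduct K 4 := by
  have h := (tendsto_prod_ramanujanTheta (a := -X) (b := -X ^ 3) (dvd_neg.mpr (dvd_refl (X : K⟦X⟧)))
    (dvd_neg.mpr (dvd_pow_self (X : K⟦X⟧) (n := 3) (by omega)))).mul
    (tendsto_eulerProduct K two_pos two_pos)
  have h' := (tendsto_eulerProduct K one_pos four_pos).mul
    (tendsto_eulerProduct K four_pos one_pos)
  refine tendsto_nhds_unique h (h'.congr fun N ↦ ?_)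
  simp only [one_mul, neg_mul_neg]
  induction N with
  | zero => simp
  | succ N ih =>
    simp only [prod_range_two_mul, prod_range_four_mul, Finset.prod_range_succ]
    linear_combination (1 - X ^ (4 * N + 1)) * (1 - X ^ (4 * N + 1 + 1)) *
      (1 - X ^ (4 * N + 2 + 1)) * (1 - X ^ (4 * N + 3 + 1)) * (1 - X ^ (4 * (N + 1))) * ih

theorem ramanujanTheta_neg_self {m : ℕ} (hm : 0 < m) :
    ramanujanTheta (-X ^ m : K⟦X⟧) (-X ^ m) * eulerProduct K (2 * m) = eulerProduct K m ^ 2 := by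
  have hX : X ∣ (-X ^ m : K⟦X⟧) := dvd_neg.mpr (dvd_pow_self X hm.ne')
  have h := (tendsto_prod_ramanujanTheta hX hX).mul
    (tendsto_eulerProduct K (m := 2 * m) (by omega) one_pos)
  have h' := (tendsto_eulerProduct K hm two_pos).pow 2
  refine tendsto_nhds_unique h (h'.congr fun N ↦ ?_)
  simp only [one_mul, neg_mul_neg]
  induction N with
  | zero => simp
  | succ N ih =>
    simp only [prod_range_two_mul, Finset.prod_range_succ]
    linear_combination (1 - X ^ (m * (2 * N + 1))) ^ 2 * (1 - X ^ (m * (2 * N + 1 + 1))) ^ 2 * ih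

end EulerProducts

section Expand

variable {K : Type*} [Field K] [TopologicalSpace K]

theorem continuous_expand {p : ℕ} (hp : p ≠ 0) : Continuous (expand p hp : K⟦X⟧ →ₐ[K] K⟦X⟧) := by
  rw [continuous_iff_continuousAt]
  intro F
  rw [ContinuousAt, tendsto_iff_coeff_tendsto]
  intro d
  simp only [coeff_expand]
  split_ifs with h
  · exact (continuous_coeff K _).tendsto F
  · exact tendsto_const_nhds

theorem expand_eulerProduct [T2Space K] {p m : ℕ} (hp : p ≠ 0) (hm : 0 < m) :
    expand p hp (eulerProduct K m) = eulerProduct K (p * m) := by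
  refine tendsto_nhds_unique
    (((continuous_expand hp).tendsto _).comp (tendsto_eulerProduct K hm one_pos)) ?_
  refine (tendsto_eulerProduct K (m := p * m) (by positivity) one_pos).congr fun N ↦ ?_
  simp [map_prod, pow_mul]

theorem eulerProduct_pow_char [T2Space K] [IsTopologicalRing K] {p m : ℕ} [Fact p.Prime]
    [CharP K p] (hm : 0 < m) : eulerProduct K m ^ p = eulerProduct K (p * m) := by
  have : CharP K⟦X⟧ p := charP_of_injective_algebraMap (algebraMap K K⟦X⟧).injective p
  refine tendsto_nhds_unique ((tendsto_eulerProduct K hm one_pos).pow p) ?_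
  have hp := (Fact.out : p.Prime).pos
  refine (tendsto_eulerProduct K (m := p * m) (by positivity) one_pos).congr fun N ↦ ?_
  rw [← Finset.prod_pow]
  refine Finset.prod_congr rfl fun i _ ↦ ?_
  rw [sub_pow_char, one_pow, ← pow_mul]
  ring_nf

end Expand

section Trisection

variable {K : Type*} [Field K]

/-- The series whose `n`-th coefficient is the `(3 n + r)`-th coefficient of `F`. -/
noncomputable def trisect (r : ℕ) (F : K⟦X⟧) : K⟦X⟧ := PowerSeries.mk fun n ↦ coeff (3 * n + r) F

@[simp]
theorem coeff_trisect (r n : ℕ) (F : K⟦X⟧) : coeff n (trisect r F) = coeff (3 * n + r) F :=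
  coeff_mk ..

theorem trisect_mul_expand {r : ℕ} (hr : r < 3) (F G : K⟦X⟧) :
    trisect r (F * expand 3 three_ne_zero G) = trisect r F * G := by
  ext n
  rw [coeff_trisect, coeff_mul, coeff_mul]
  symm
  refine Finset.sum_of_injOn (fun x ↦ (3 * x.1 + r, 3 * x.2)) ?_ ?_ ?_ ?_
  · rintro ⟨a, b⟩ _ ⟨c, d⟩ _ h
    simp at h ⊢
    omega
  · rintro ⟨a, b⟩ h
    simp at h ⊢
    omega
  · rintro ⟨a, b⟩ h h'
    simp only [coeff_expand]
    split_ifs with hb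
    · obtain ⟨b, rfl⟩ := hb
      simp at h
      refine absurd ⟨(n - b, b), ?_, ?_⟩ h'
      · simp; omega
      · simp; omega
    · simp
  · rintro ⟨a, b⟩ _
    simp [coeff_expand]

theorem trisect_X_pow {r : ℕ} (hr : r < 3) (e : ℕ) :
    trisect r (X ^ e : K⟦X⟧) = if e % 3 = r then X ^ (e / 3) else 0 := by
  ext n
  rw [coeff_trisect, coeff_X_pow]
  split_ifs with h₁ h₂ h₂
  · rw [coeff_X_pow, if_pos (by omega)]
  · omega
  · rw [coeff_X_pow, if_neg (by omega)]
  · simp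

theorem thetaTerm_X_pow (i j : ℕ) (n : ℤ) :
    thetaTerm (X ^ i : K⟦X⟧) (X ^ j) n = X ^ (i * triangular n + j * triangular (-n)) := by
  rw [thetaTerm, ← pow_mul, ← pow_mul, ← pow_add]

variable [TopologicalSpace K] [T2Space K]

theorem trisect_eq_of_hasSum {ι κ : Type*} {r : ℕ} (hr : r < 3) {e : ι → ℕ} {e' : κ → ℕ}
    {F G : K⟦X⟧} (hF : HasSum (fun i ↦ X ^ e i) F) (hG : HasSum (fun k ↦ X ^ e' k) G) (g : κ → ι)
    (hg : g.Injective) (he : ∀ k, e (g k) = 3 * e' k + r)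
    (hrange : ∀ i, e i % 3 = r → i ∈ Set.range g) : trisect r F = G := by
  have h : HasSum (fun i ↦ trisect r (X ^ e i)) (trisect r F) := by
    rw [hasSum_iff_hasSum_coeff] at hF ⊢
    simpa using fun d ↦ hF (3 * d + r)
  rw [← hg.hasSum_iff] at h
  · refine h.unique ?_
    convert hG using 1
    ext1 k
    have hk := he k
    rw [Function.comp_apply, trisect_X_pow hr, if_pos (by omega),
      show e (g k) / 3 = e' k by omega]
  · intro i hi
    rw [trisect_X_pow hr, if_neg fun h ↦ hi (hrange i h)]

variable (K) in
theorem trisect_ramanujanTheta_one_three :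
    trisect 0 (ramanujanTheta (X : K⟦X⟧) (X ^ 3)) = ramanujanTheta X (X ^ 2) := by
  have hX (i : ℕ) : (X : K⟦X⟧) ∣ X ^ (i + 1) := dvd_pow_self X i.succ_ne_zero
  have hF := hasSum_ramanujanTheta (hX 0) (hX 2)
  have hG := hasSum_ramanujanTheta (hX 0) (hX 1)
  have e (i j : ℕ) : thetaTerm (X ^ i : K⟦X⟧) (X ^ j) =
      fun n ↦ X ^ (i * triangular n + j * triangular (-n)) := funext (thetaTerm_X_pow i j)
  rw [e] at hF hG
  norm_num only [pow_one] at hF hG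
  refine trisect_eq_of_hasSum (by norm_num) hF hG
    (fun m ↦ if m % 2 = 0 then 3 * (m / 2) else 3 * ((1 - m) / 2) - 1) ?_ ?_ ?_
  · intro a b h
    dsimp only at h
    split_ifs at h <;> omega
  · intro m
    split_ifs with h
    · obtain ⟨l, rfl⟩ : ∃ l, m = 2 * l := ⟨m / 2, by omega⟩
      rw [show 2 * l / 2 = l by omega]
      zify
      linarith [triangular_neg (3 * l), triangular_neg (2 * l), two_mul_triangular (3 * l),
        two_mul_triangular (2 * l)]
    · obtain ⟨l, rfl⟩ : ∃ l, m = 1 - 2 * l := ⟨(1 - m) / 2, by omega⟩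
      rw [show (1 - (1 - 2 * l)) / 2 = l by omega]
      zify
      linarith [triangular_neg (3 * l - 1), triangular_neg (1 - 2 * l),
        two_mul_triangular (3 * l - 1), two_mul_triangular (1 - 2 * l)]
  · intro n h
    have h₁ := triangular_neg n
    have h₂ := two_mul_triangular n
    have h₃ : n % 3 = 0 ∨ n % 3 = 2 := by
      by_contra! h₄
      obtain ⟨k, rfl⟩ : ∃ k, n = 3 * k + 1 := ⟨n / 3, by omega⟩
      have : (2 : ℤ) * (triangular (3 * k + 1)) = 3 * (3 * k * k + 3 * k) + 2 := by linarith
      omega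
    rcases h₃ with h₃ | h₃
    · exact ⟨2 * (n / 3), by simp only; split_ifs <;> omega⟩
    · exact ⟨1 - 2 * ((n + 1) / 3), by simp only; split_ifs <;> omega⟩

variable [IsTopologicalRing K]

theorem hasSum_thetaTerm_mul_thetaTerm {a b c d : K⟦X⟧} (ha : X ∣ a) (hb : X ∣ b) (hc : X ∣ c)
    (hd : X ∣ d) : HasSum (fun x : ℤ × ℤ ↦ thetaTerm a b x.1 * thetaTerm c d x.2)
      (ramanujanTheta a b * ramanujanTheta c d) := by
  refine (hasSum_ramanujanTheta ha hb).mul (hasSum_ramanujanTheta hc hd)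
    ((summable_iff_summable_coeff K).mpr fun n ↦ summable_of_hasFiniteSupport ?_)
  refine ((Set.finite_Icc (-(n : ℤ)) n).prod (Set.finite_Icc (-(n : ℤ)) n)).subset fun x hx ↦ ?_
  by_contra h
  refine hx ((X_pow_dvd_iff (n := n + 1)).mp ?_ n n.lt_succ_self)
  by_cases h₁ : n + 1 ≤ x.1.natAbs
  · exact (X_pow_dvd_thetaTerm ha hb h₁).mul_right _
  · refine (X_pow_dvd_thetaTerm hc hd ?_).mul_left _
    simp only [Set.mem_prod, Set.mem_Icc] at h
    omega

variable (K)

theorem trisect_ramanujanTheta_mul :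
    trisect 1 (ramanujanTheta (X : K⟦X⟧) (X ^ 2) * ramanujanTheta (X ^ 2) (X ^ 4)) =
      ramanujanTheta X (X ^ 2) * ramanujanTheta X (X ^ 5) := by
  have hX (i : ℕ) : (X : K⟦X⟧) ∣ X ^ (i + 1) := dvd_pow_self X i.succ_ne_zero
  have hF := hasSum_thetaTerm_mul_thetaTerm (hX 0) (hX 1) (hX 1) (hX 3)
  have hG := hasSum_thetaTerm_mul_thetaTerm (hX 0) (hX 1) (hX 0) (hX 4)
  simp only [thetaTerm_X_pow, ← pow_add] at hF hG
  norm_num only [pow_one] at hF hG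
  refine trisect_eq_of_hasSum (by norm_num) hF hG (fun x ↦ (1 - x.1 - 2 * x.2, x.2 - x.1)) ?_ ?_ ?_
  · rintro ⟨a, b⟩ ⟨c, d⟩ h
    simp at h ⊢
    omega
  · rintro ⟨u, v⟩
    have h₁ := triangular_neg (1 - u - 2 * v)
    have h₂ := triangular_neg (v - u)
    have h₃ := triangular_neg u
    have h₄ := triangular_neg v
    have h₅ := two_mul_triangular (1 - u - 2 * v)
    have h₆ := two_mul_triangular (v - u)
    have h₇ := two_mul_triangular u
    have h₈ := two_mul_triangular v
    simp only
    zify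
    linarith
  · rintro ⟨k, l⟩ h
    have h₁ := triangular_neg k
    have h₂ := triangular_neg l
    have h₃ : (k - l) % 3 = 1 := by
      dsimp only at h
      omega
    exact ⟨((1 - k + l) / 3 - l, (1 - k + l) / 3), by simp; omega⟩

end Trisection

section GeneratingFunction

variable (K : Type*) [Field K] [TopologicalSpace K] [T2Space K] [IsTopologicalRing K]

theorem hasProd_ped : HasProd
    (fun i ↦ if Even (i + 1) then 1 + X ^ (i + 1) else ∑' j, X ^ ((i + 1) * j))
    (PowerSeries.mk fun n ↦ (ped n : K)) := by
  convert! Nat.Partition.hasProd_genFun (fun i c ↦ if Even i → c ≤ 1 then (1 : K) else 0) using 1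
  · ext1 i
    split_ifs with h
    · rw [tsum_eq_single 0 fun j hj ↦ by simp [h, hj]]
      simp
    · rw [tsum_eq_zero_add']
      · simp [h]
      · simp_rw [pow_mul, pow_add]
        apply Summable.mul_right
        exact summable_pow_of_constantCoeff_eq_zero (by simp)
  · simp_rw [Nat.Partition.genFun, Finsupp.prod, Finset.prod_boole]
    ext n
    rw [coeff_mk, coeff_mk, Finset.sum_boole, ped]
    congr 1
    refine Nat.subtype_card _ fun p ↦ ?_
    simp only [Finset.mem_filter_univ, Multiset.toFinsupp_support, Multiset.mem_toFinset,
      Multiset.toFinsupp_apply]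
    refine forall_congr' fun i ↦ ⟨fun h hi ↦ ?_, fun h _ ↦ h⟩
    by_cases hp : i ∈ p.parts
    · exact h hp hi
    · simp [Multiset.count_eq_zero_of_notMem hp]

theorem mk_ped_mul_eulerProduct :
    (PowerSeries.mk fun n ↦ (ped n : K)) * eulerProduct K 1 = eulerProduct K 4 := by
  have h := ((hasProd_ped K).tendsto_prod_nat.comp (tendsto_mul_left_atTop two_pos)).mul
    (tendsto_eulerProduct K one_pos two_pos)
  refine tendsto_nhds_unique h ((tendsto_eulerProduct K four_pos one_pos).congr fun N ↦ ?_)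
  rw [Function.comp_apply, ← Finset.prod_mul_distrib, one_mul]
  induction N with
  | zero => simp
  | succ N ih =>
    rw [prod_range_two_mul, Finset.prod_range_succ, ih, if_neg (by grind), if_pos (by grind)]
    simp_rw [pow_mul _ (2 * N + 1)]
    rw [one_mul, tsum_pow_mul_one_sub_of_constantCoeff_eq_zero (by simp)]
    ring

end GeneratingFunction

theorem trisect_trisect_mk_ped :
    trisect 0 (trisect 1 (PowerSeries.mk fun n ↦ (ped n : ZMod 3))) =
      ramanujanTheta (-X) (-X ^ 3) * ramanujanTheta (-X ^ 3) (-X ^ 3) := by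
  have : Fact (Nat.Prime 3) := ⟨Nat.prime_three⟩
  set P := PowerSeries.mk fun n ↦ (ped n : ZMod 3)
  have hE {m : ℕ} (hm : 0 < m) := eulerProduct_ne_zero (ZMod 3) hm
  have h₁ : P * eulerProduct (ZMod 3) 1 = eulerProduct (ZMod 3) 4 := mk_ped_mul_eulerProduct _
  have h₂ := ramanujanTheta_one_two (ZMod 3) one_pos
  have h₃ := ramanujanTheta_one_two (ZMod 3) two_pos
  have h₄ := ramanujanTheta_one_five (ZMod 3)
  have h₅ := eulerProduct_pow_char (K := ZMod 3) (p := 3) one_pos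
  have h₆ := ramanujanTheta_one_three (ZMod 3)
  have h₇ := ramanujanTheta_neg_one_neg_three (ZMod 3)
  have h₈ := ramanujanTheta_neg_self (ZMod 3) three_pos
  have e₁ := expand_eulerProduct (K := ZMod 3) three_ne_zero one_pos
  have e₂ := expand_eulerProduct (K := ZMod 3) three_ne_zero two_pos
  have e₄ := expand_eulerProduct (K := ZMod 3) three_ne_zero four_pos
  norm_num only [pow_one] at h₂ h₃ h₅ h₈ e₁ e₂ e₄
  have hP : P * expand 3 three_ne_zero (eulerProduct (ZMod 3) 1 ^ 2 * eulerProduct (ZMod 3) 2) =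
      ramanujanTheta X (X ^ 2) * ramanujanTheta (X ^ 2) (X ^ 4) *
        expand 3 three_ne_zero (eulerProduct (ZMod 3) 4) := by
    rw [map_mul, map_pow, e₁, e₂, e₄]
    refine mul_right_cancel₀ (mul_ne_zero (hE one_pos) (hE two_pos)) ?_
    linear_combination (eulerProduct (ZMod 3) 2 * eulerProduct (ZMod 3) 3 ^ 2 *
      eulerProduct (ZMod 3) 6) * h₁ - ramanujanTheta X (X ^ 2) * eulerProduct (ZMod 3) 1 * h₃ -
      eulerProduct (ZMod 3) 4 * eulerProduct (ZMod 3) 6 * h₂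
  have hS := congrArg (trisect 1) hP
  rw [trisect_mul_expand (by norm_num), trisect_mul_expand (by norm_num),
    trisect_ramanujanTheta_mul] at hS
  have hS' : trisect 1 P * expand 3 three_ne_zero (eulerProduct (ZMod 3) 2 ^ 2) =
      ramanujanTheta X (X ^ 3) *
        expand 3 three_ne_zero (eulerProduct (ZMod 3) 1 ^ 2 * eulerProduct (ZMod 3) 4) := by
    rw [map_mul, map_pow, map_pow, e₁, e₂, e₄]
    refine mul_right_cancel₀ (mul_ne_zero (pow_ne_zero 4 (hE one_pos)) (hE two_pos)) ?_
    linear_combination eulerProduct (ZMod 3) 1 ^ 2 * eulerProduct (ZMod 3) 6 ^ 2 * hS +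
      ramanujanTheta X (X ^ 5) * eulerProduct (ZMod 3) 4 * eulerProduct (ZMod 3) 1 *
        eulerProduct (ZMod 3) 6 * h₂ +
      eulerProduct (ZMod 3) 2 * eulerProduct (ZMod 3) 3 ^ 2 * h₄ -
      eulerProduct (ZMod 3) 1 ^ 3 * eulerProduct (ZMod 3) 2 * eulerProduct (ZMod 3) 3 ^ 2 *
        eulerProduct (ZMod 3) 12 * h₆ -
      eulerProduct (ZMod 3) 2 ^ 3 * eulerProduct (ZMod 3) 3 ^ 2 * eulerProduct (ZMod 3) 12 * h₅
  have hD := congrArg (trisect 0) hS'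
  rw [trisect_mul_expand (by norm_num), trisect_mul_expand (by norm_num),
    trisect_ramanujanTheta_one_three] at hD
  refine mul_right_cancel₀ (mul_ne_zero (pow_ne_zero 2 (hE two_pos)) (hE (m := 6) (by norm_num))) ?_
  linear_combination eulerProduct (ZMod 3) 6 * hD +
    eulerProduct (ZMod 3) 1 * eulerProduct (ZMod 3) 4 * h₂ -
    eulerProduct (ZMod 3) 2 * ramanujanTheta (-X ^ 3) (-X ^ 3) * eulerProduct (ZMod 3) 6 * h₇ -
    eulerProduct (ZMod 3) 1 * eulerProduct (ZMod 3) 4 * eulerProduct (ZMod 3) 2 * h₈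

theorem exists_sq_add_of_ped_ne_zero {M : ℕ} (h : (ped (9 * M + 1) : ZMod 3) ≠ 0) :
    ∃ x y : ℤ, x ^ 2 + 24 * y ^ 2 = 8 * M + 1 := by
  have hX (i : ℕ) : (X : (ZMod 3)⟦X⟧) ∣ -X ^ (i + 1) :=
    dvd_neg.mpr (dvd_pow_self X i.succ_ne_zero)
  have hs := (hasSum_iff_hasSum_coeff (ZMod 3)).mp
    (hasSum_thetaTerm_mul_thetaTerm (hX 0) (hX 2) (hX 2) (hX 2)) M
  have hM := congrArg (coeff M) trisect_trisect_mk_ped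
  rw [coeff_trisect, coeff_trisect, coeff_mk, show 3 * (3 * M + 0) + 1 = 9 * M + 1 by ring] at hM
  norm_num only [pow_one] at hs
  rw [← hM] at hs
  by_contra! hc
  refine h (hs.unique ?_)
  convert hasSum_zero with x
  obtain ⟨k, l⟩ := x
  have hk : thetaTerm (-X : (ZMod 3)⟦X⟧) (-X ^ 3) k * thetaTerm (-X ^ 3) (-X ^ 3) l =
      (-1) ^ (triangular k + triangular (-k) + triangular l + triangular (-l)) *
        X ^ (triangular k + 3 * triangular (-k) + 3 * triangular l + 3 * triangular (-l)) := by
    simp only [thetaTerm, neg_pow X, neg_pow (X ^ 3)]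
    ring
  have hne : M ≠ triangular k + 3 * triangular (-k) + 3 * triangular l + 3 * triangular (-l) := by
    rintro rfl
    refine hc (4 * k - 1) l ?_
    push_cast
    linarith [triangular_neg k, triangular_neg l, two_mul_triangular k, two_mul_triangular l]
  rw [hk]
  rcases neg_one_pow_eq_or (ZMod 3)⟦X⟧
    (triangular k + triangular (-k) + triangular l + triangular (-l)) with h | h <;>
    simp [h, coeff_X_pow, hne]

theorem sq_add_ne (α n : ℕ) (x y : ℤ) : x ^ 2 + 24 * y ^ 2 ≠ 9 ^ α * (24 * n + 17) := by
  induction α generalizing x y with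
  | zero =>
    intro h
    obtain ⟨k, rfl | rfl | rfl⟩ : ∃ k, x = 3 * k ∨ x = 3 * k + 1 ∨ x = 3 * k + 2 :=
      ⟨x / 3, by omega⟩ <;> ring_nf at h <;> omega
  | succ α ih =>
    intro h
    rw [pow_succ 9] at h
    obtain ⟨x, rfl⟩ : 3 ∣ x := Int.prime_three.dvd_of_dvd_pow (n := 2) (by
      have : x ^ 2 + 24 * y ^ 2 = 9 * (9 ^ α * (24 * n + 17)) := by linarith
      omega)
    obtain ⟨y, rfl⟩ : 3 ∣ y := Int.prime_three.dvd_of_dvd_pow (n := 2) (by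
      have : 9 * x ^ 2 + 24 * y ^ 2 = 9 * (9 ^ α * (24 * n + 17)) := by linarith
      omega)
    exact ih x y (by linarith)

theorem ped_cong_17 (n α : ℕ) :
    ped (3 ^ (2 * α + 3) * n + (17 * 3 ^ (2 * α + 2) - 1) / 8) ≡ 0 [MOD 3] := by
  rw [Nat.modEq_zero_iff_dvd, ← ZMod.natCast_eq_zero_iff]
  have h : 9 ^ α % 8 = 1 := by simp [Nat.pow_mod]
  have h₂ : 3 ^ (2 * α + 2) = 9 * 9 ^ α := by rw [pow_add, pow_mul]; ring
  obtain ⟨M, hM⟩ : ∃ M, 8 * M + 1 = 9 ^ α * (24 * n + 17) :=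
    ⟨9 ^ α * (24 * n + 17) / 8, by grind⟩
  have hN : 3 ^ (2 * α + 3) * n + (17 * 3 ^ (2 * α + 2) - 1) / 8 = 9 * M + 1 := by
    rw [pow_succ, h₂]
    have : 9 ^ α * (24 * n + 17) = 24 * (9 ^ α * n) + 17 * 9 ^ α := by ring
    rw [show 9 * 9 ^ α * 3 * n = 27 * (9 ^ α * n) by ring]
    omega
  rw [hN]
  by_contra hc
  obtain ⟨x, y, hxy⟩ := exists_sq_add_of_ped_ne_zero hc
  refine sq_add_ne α n x y (hxy.trans ?_)
  exact_mod_cast hM
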